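/- arXiv:2102.09318 — 3 statements merged into one kernel-verified Lean document; each statement's English description precedes it below -/
import Mathlib

section
/- For any policy π, the matrix I − γ P_{π_ρ̄} D_π is invertible with ‖(I − γ P_{π_ρ̄} D_π)^{-1}‖∞ ≤ 1/(1−γ); consequently the modified Bellman equation Q = R + γ P_{π_ρ̄} D_π Q has a unique solution Q^{ρ̄,π} ∈ ℝ^{S×A}. -/
noncomputable def supNorm {I : Type*} [Fintype I] [Nonempty I] (f : I → ℝ) : ℝ :=
  Finset.univ.sup' Finset.univ_nonempty (fun i => |f i|)

noncomputable def matNorm {I : Type*} [Fintype I] [Nonempty I] (M : Matrix I I ℝ) : ℝ :=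
  supNorm (fun i => ∑ j, |M i j|)

/-- `π` is a policy: for each state `s`, `π s` is a probability distribution on actions. -/
def IsPolicy {S A : Type*} [Fintype A] (π : S → A → ℝ) : Prop :=
  (∀ s a, 0 ≤ π s a) ∧ ∀ s, ∑ a, π s a = 1

/-- A row-stochastic matrix. -/
def IsStochastic {S : Type*} [Fintype S] (P : Matrix S S ℝ) : Prop :=
  (∀ s s', 0 ≤ P s s') ∧ ∀ s, ∑ s', P s s' = 1

/-- The state-action transition matrix `P_π((s,a),(s',a')) = P_a(s,s') π(a'|s')`. -/
def Psa {S A : Type*} (P : A → Matrix S S ℝ) (π : S → A → ℝ) :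
    Matrix (S × A) (S × A) ℝ :=
  Matrix.of fun p q => P p.2 p.1 q.1 * π q.1 q.2

/-- The truncated policy `π_ρ̄(a|s) = min(ρ̄ π_b(a|s), π(a|s)) / Σ_{a'} min(ρ̄ π_b(a'|s), π(a'|s))`. -/
noncomputable def truncPolicy {S A : Type*} [Fintype A] (πb π : S → A → ℝ) (ρ : ℝ) :
    S → A → ℝ :=
  fun s a => min (ρ * πb s a) (π s a) / ∑ a', min (ρ * πb s a') (π s a')

/-- The diagonal matrix with `D_π((s,a),(s,a)) = Σ_{a'} min(ρ̄ π_b(a'|s), π(a'|s))`. -/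
noncomputable def truncDiag {S A : Type*} [Fintype A] [DecidableEq S] [DecidableEq A]
    (πb π : S → A → ℝ) (ρ : ℝ) : Matrix (S × A) (S × A) ℝ :=
  Matrix.diagonal (fun p => ∑ a', min (ρ * πb p.1 a') (π p.1 a'))

open scoped Matrix.Norms.Operator in
/-- If every absolute row sum of `M` is at most `1` and `0 ≤ γ < 1`, then `1 - γ M` is invertible
and the absolute row sums of its inverse are at most `1 / (1 - γ)`. -/
theorem isUnit_one_sub_smul_and_matNorm_inv_le {I : Type*} [Fintype I] [Nonempty I]
    [DecidableEq I] (M : Matrix I I ℝ) (hM : ∀ i, ∑ j, |M i j| ≤ 1)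
    {γ : ℝ} (hγ0 : 0 ≤ γ) (hγ1 : γ < 1) :
    IsUnit (1 - γ • M) ∧ matNorm (1 - γ • M)⁻¹ ≤ 1 / (1 - γ) := by
  have norm_le_iff (N : Matrix I I ℝ) {r : ℝ} (hr : 0 ≤ r) :
      ‖N‖ ≤ r ↔ ∀ i, ∑ j, |N i j| ≤ r := by
    lift r to NNReal using hr
    rw [Matrix.linfty_opNorm_def, NNReal.coe_le_coe, Finset.sup_le_iff]
    simp [← NNReal.coe_le_coe]
  have hM' : ‖M‖ ≤ 1 := (norm_le_iff M zero_le_one).2 hM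
  have hγM : ‖γ • M‖ ≤ γ := by
    rw [norm_smul, Real.norm_of_nonneg hγ0]
    exact mul_le_of_le_one_right hγ0 hM'
  have hU : IsUnit (1 - γ • M) := isUnit_one_sub_of_norm_lt_one (hγM.trans_lt hγ1)
  refine ⟨hU, ?_⟩
  set B := (1 - γ • M)⁻¹
  have hB : B = 1 + γ • M * B := by
    have h : (1 - γ • M) * B = 1 :=
      Matrix.mul_nonsing_inv _ ((Matrix.isUnit_iff_isUnit_det _).1 hU)
    rw [sub_mul, one_mul] at h
    exact sub_eq_iff_eq_add.1 h
  have hB' : ‖B‖ ≤ 1 + γ * ‖B‖ := calc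
    ‖B‖ = ‖1 + γ • M * B‖ := by rw [← hB]
    _ ≤ ‖(1 : Matrix I I ℝ)‖ + ‖γ • M‖ * ‖B‖ :=
      (norm_add_le _ _).trans (by gcongr; exact norm_mul_le _ _)
    _ ≤ 1 + γ * ‖B‖ := by
      gcongr
      exact norm_one.le
  have h1 : 0 < 1 - γ := sub_pos.2 hγ1
  have hBnorm : ‖B‖ ≤ 1 / (1 - γ) := by
    rw [le_div_iff₀ h1]
    linarith
  refine Finset.sup'_le Finset.univ_nonempty _ fun i _ => ?_
  rw [abs_of_nonneg (Finset.sum_nonneg fun _ _ => abs_nonneg _)]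
  exact (norm_le_iff B (by positivity)).1 hBnorm i

theorem Psa_truncPolicy_mul_truncDiag_apply {S A : Type*} [Fintype S] [Fintype A]
    [DecidableEq S] [DecidableEq A] (P : A → Matrix S S ℝ) {πb π : S → A → ℝ} {ρ : ℝ}
    (hm : ∀ s a, 0 ≤ min (ρ * πb s a) (π s a)) (p q : S × A) :
    (Psa P (truncPolicy πb π ρ) * truncDiag πb π ρ) p q =
      P p.2 p.1 q.1 * min (ρ * πb q.1 q.2) (π q.1 q.2) := by
  rw [truncDiag, Matrix.mul_diagonal, Psa, Matrix.of_apply, truncPolicy, mul_assoc,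
    div_mul_cancel_of_imp]
  intro h
  exact (Finset.sum_eq_zero_iff_of_nonneg fun a _ => hm q.1 a).1 h q.2 (Finset.mem_univ _)

theorem sum_abs_Psa_truncPolicy_mul_truncDiag_le_one {S A : Type*} [Fintype S] [Fintype A]
    [DecidableEq S] [DecidableEq A] {P : A → Matrix S S ℝ} (hP : ∀ a, IsStochastic (P a))
    {πb π : S → A → ℝ} {ρ : ℝ} (hm : ∀ s a, 0 ≤ min (ρ * πb s a) (π s a))
    (hπ : IsPolicy π) (p : S × A) :
    ∑ q, |(Psa P (truncPolicy πb π ρ) * truncDiag πb π ρ) p q| ≤ 1 := by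
  calc
    _ = ∑ s, P p.2 p.1 s * ∑ a, min (ρ * πb s a) (π s a) := by
      simp_rw [Psa_truncPolicy_mul_truncDiag_apply P hm, Fintype.sum_prod_type, Finset.mul_sum]
      exact Finset.sum_congr rfl fun s _ => Finset.sum_congr rfl fun a _ =>
        abs_of_nonneg (mul_nonneg ((hP p.2).1 _ _) (hm s a))
    _ ≤ ∑ s, P p.2 p.1 s := by
      refine Finset.sum_le_sum fun s _ => mul_le_of_le_one_right ((hP p.2).1 _ _) ?_
      rw [← hπ.2 s]
      exact Finset.sum_le_sum fun a _ => min_le_right _ _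
    _ = 1 := (hP p.2).2 p.1

/-- For any policy `π`, the matrix `I − γ P_{π_ρ̄} D_π` is invertible with
`‖(I − γ P_{π_ρ̄} D_π)⁻¹‖_∞ ≤ 1/(1−γ)`; consequently the modified Bellman equation
`Q = R + γ P_{π_ρ̄} D_π Q` has a unique solution. -/
theorem modified_bellman_invertible
    {S A : Type*} [Fintype S] [Fintype A] [Nonempty S] [Nonempty A]
    [DecidableEq S] [DecidableEq A]
    (P : A → Matrix S S ℝ) (hP : ∀ a, IsStochastic (P a))
    (R : S × A → ℝ) (hR : ∀ x, 0 ≤ R x ∧ R x ≤ 1)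
    (γ : ℝ) (hγ0 : 0 < γ) (hγ1 : γ < 1)
    (πb : S → A → ℝ) (hπb : IsPolicy πb) (hπbpos : ∀ s a, 0 < πb s a)
    (c ρ : ℝ) (hc : 1 ≤ c) (hcρ : c ≤ ρ)
    (π : S → A → ℝ) (hπ : IsPolicy π) :
    IsUnit ((1 : Matrix (S × A) (S × A) ℝ)
        - γ • (Psa P (truncPolicy πb π ρ) * truncDiag πb π ρ)) ∧
    matNorm (((1 : Matrix (S × A) (S × A) ℝ)
        - γ • (Psa P (truncPolicy πb π ρ) * truncDiag πb π ρ))⁻¹) ≤ 1 / (1 - γ) ∧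
    ∃! Q : S × A → ℝ,
      Q = R + γ • (Psa P (truncPolicy πb π ρ) * truncDiag πb π ρ).mulVec Q := by
  have hm (s : S) (a : A) : 0 ≤ min (ρ * πb s a) (π s a) :=
    le_min (mul_nonneg (by linarith) (hπbpos s a).le) (hπ.1 s a)
  obtain ⟨hU, hnorm⟩ := isUnit_one_sub_smul_and_matNorm_inv_le _
    (sum_abs_Psa_truncPolicy_mul_truncDiag_le_one hP hm hπ) hγ0.le hγ1
  refine ⟨hU, hnorm, ?_⟩
  obtain ⟨Q, hQ, huniq⟩ := Function.Bijective.existsUnique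
    ⟨Matrix.mulVec_injective_iff_isUnit.2 hU, Matrix.mulVec_surjective_iff_isUnit.2 hU⟩ R
  simp only [Matrix.sub_mulVec, Matrix.one_mulVec, Matrix.smul_mulVec, sub_eq_iff_eq_add]
    at hQ huniq
  exact ⟨Q, hQ, huniq⟩
end

section
/- Suppose μ_b(s) > 0 for all s and c̄ · min_{(s,a)} π_b(a|s) ≤ 1. Let C_min = c̄ min_{(s,a)} π_b(a|s) and M_min = min_{(s,a)} μ_b(s)π_b(a|s). Then the matrix A = I − Σ_{i=0}^{n−1} γ^i M (P_{π_c̄} C_π)^i (I − γ P_{π_ρ̄} D_π) has nonnegative entries and satisfies ‖A‖∞ ≤ γ_c, where γ_c = 1 − M_min(1−γ)(1−(γ C_min)^n)/(1−γ C_min) ∈ (0,1). In particular, the map Q ↦ A Q + b is a contraction with respect to ‖·‖∞ with contraction factor γ_c, for any b ∈ ℝ^{S×A}. -/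
/-- The matrix `A = I − Σ_{i<n} γ^i M (P_{π_c̄} C_π)^i (I − γ P_{π_ρ̄} D_π)`. -/
noncomputable def AmatQ {S A : Type*} [Fintype S] [Fintype A] [DecidableEq S] [DecidableEq A]
    (P : A → Matrix S S ℝ) (πb π : S → A → ℝ) (μb : S → ℝ) (γ c ρ : ℝ) (n : ℕ) :
    Matrix (S × A) (S × A) ℝ :=
  1 - ∑ i ∈ Finset.range n, γ ^ i •
    (Matrix.diagonal (fun p : S × A => μb p.1 * πb p.1 p.2) *
      (Psa P (truncPolicy πb π c) * truncDiag πb π c) ^ i *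
      (1 - γ • (Psa P (truncPolicy πb π ρ) * truncDiag πb π ρ)))

section NormBounds

variable {I : Type*} [Fintype I] [Nonempty I]

lemma abs_le_supNorm (f : I → ℝ) (i : I) : |f i| ≤ supNorm f :=
  Finset.le_sup' (fun i => |f i|) (Finset.mem_univ i)

lemma supNorm_le {f : I → ℝ} {r : ℝ} (h : ∀ i, |f i| ≤ r) : supNorm f ≤ r :=
  Finset.sup'_le _ _ fun i _ => h i

lemma supNorm_nonneg (f : I → ℝ) : 0 ≤ supNorm f :=
  (abs_nonneg _).trans (abs_le_supNorm f (Classical.arbitrary I))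

lemma supNorm_mulVec_le (B : Matrix I I ℝ) (x : I → ℝ) :
    supNorm (B.mulVec x) ≤ matNorm B * supNorm x := by
  refine supNorm_le fun i => ?_
  calc |∑ j, B i j * x j| ≤ ∑ j, |B i j * x j| := Finset.abs_sum_le_sum_abs _ _
    _ ≤ ∑ j, |B i j| * supNorm x := by
        refine Finset.sum_le_sum fun j _ => ?_
        rw [abs_mul]
        exact mul_le_mul_of_nonneg_left (abs_le_supNorm x j) (abs_nonneg _)
    _ = (∑ j, |B i j|) * supNorm x := (Finset.sum_mul _ _ _).symm
    _ ≤ matNorm B * supNorm x := by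
        refine mul_le_mul_of_nonneg_right ?_ (supNorm_nonneg x)
        exact (le_abs_self _).trans (abs_le_supNorm (fun i => ∑ j, |B i j|) i)

lemma matNorm_le_of_nonneg {B : Matrix I I ℝ} {r : ℝ} (hB : ∀ i j, 0 ≤ B i j)
    (h : ∀ i, ∑ j, B i j ≤ r) : matNorm B ≤ r := by
  refine supNorm_le fun i => ?_
  rw [abs_of_nonneg (Finset.sum_nonneg fun j _ => abs_nonneg _)]
  simpa only [abs_of_nonneg (hB i _)] using h i

end NormBounds

section NonnegMatrix

variable {I : Type*} [Fintype I]

lemma mul_apply_nonneg {U V : Matrix I I ℝ} (hU : ∀ i j, 0 ≤ U i j) (hV : ∀ i j, 0 ≤ V i j)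
    (i j : I) : 0 ≤ (U * V) i j := by
  rw [Matrix.mul_apply]
  exact Finset.sum_nonneg fun k _ => mul_nonneg (hU i k) (hV k j)

lemma sum_mul_apply (U V : Matrix I I ℝ) (i : I) :
    ∑ j, (U * V) i j = ∑ k, U i k * ∑ j, V k j := by
  simp only [Matrix.mul_apply, Finset.mul_sum]
  exact Finset.sum_comm

variable [DecidableEq I]

lemma pow_apply_nonneg {U : Matrix I I ℝ} (hU : ∀ i j, 0 ≤ U i j) (k : ℕ) (i j : I) :
    0 ≤ (U ^ k) i j := by
  induction k generalizing i j with
  | zero =>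
    rw [pow_zero, Matrix.one_apply]
    split_ifs <;> norm_num
  | succ k ih =>
    rw [pow_succ]
    exact mul_apply_nonneg ih hU i j

lemma pow_le_sum_pow_apply {U : Matrix I I ℝ} (hU : ∀ i j, 0 ≤ U i j) {r : ℝ} (hr : 0 ≤ r)
    (h : ∀ i, r ≤ ∑ j, U i j) (k : ℕ) (i : I) : r ^ k ≤ ∑ j, (U ^ k) i j := by
  induction k generalizing i with
  | zero => simp [Matrix.one_apply]
  | succ k ih =>
    rw [pow_succ', pow_succ', sum_mul_apply]
    calc r * r ^ k ≤ (∑ j, U i j) * r ^ k :=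
          mul_le_mul_of_nonneg_right (h i) (pow_nonneg hr k)
      _ = ∑ j, U i j * r ^ k := Finset.sum_mul _ _ _
      _ ≤ _ := Finset.sum_le_sum fun j _ => mul_le_mul_of_nonneg_left (ih j) (hU i j)

lemma one_sub_sum_smul_eq (D U V : Matrix I I ℝ) (γ : ℝ) (n : ℕ) :
    1 - ∑ i ∈ Finset.range n, γ ^ i • (D * U ^ i * (1 - γ • V)) =
      (1 - D) + D * (∑ i ∈ Finset.range n, γ ^ (i + 1) • (U ^ i * (V - U)) + γ ^ n • U ^ n) := by
  induction n with
  | zero => simp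
  | succ n ih =>
    rw [Finset.sum_range_succ, ← sub_sub, ih, Finset.sum_range_succ]
    simp only [mul_add, mul_sub, Matrix.mul_smul, mul_one, smul_sub, smul_smul, ← pow_succ,
      mul_assoc]
    abel

/-- The bootstrapping operator built from nonnegative matrices `U ≤ V` is nonnegative. -/
lemma one_sub_sum_smul_nonneg {d : I → ℝ} {U V : Matrix I I ℝ} {γ : ℝ} (hd0 : ∀ i, 0 ≤ d i)
    (hd1 : ∀ i, d i ≤ 1) (hU : ∀ i j, 0 ≤ U i j) (hUV : ∀ i j, U i j ≤ V i j) (hγ : 0 ≤ γ)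
    (n : ℕ) (i j : I) :
    0 ≤ (1 - ∑ k ∈ Finset.range n, γ ^ k • (Matrix.diagonal d * U ^ k * (1 - γ • V))) i j := by
  rw [one_sub_sum_smul_eq, Matrix.add_apply, Matrix.diagonal_mul, Matrix.add_apply,
    Matrix.sum_apply]
  refine add_nonneg ?_ (mul_nonneg (hd0 i) (add_nonneg (Finset.sum_nonneg fun k _ => ?_) ?_))
  · rw [Matrix.sub_apply, Matrix.one_apply, Matrix.diagonal_apply]
    split_ifs
    · exact sub_nonneg.2 (hd1 i)
    · simp
  · exact mul_nonneg (pow_nonneg hγ _)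
      (mul_apply_nonneg (pow_apply_nonneg hU k) (fun i j => sub_nonneg.2 (hUV i j)) i j)
  · exact mul_nonneg (pow_nonneg hγ _) (pow_apply_nonneg hU n i j)

lemma sum_one_sub_sum_smul_le {d : I → ℝ} {U V : Matrix I I ℝ} {γ m r : ℝ} (hm : 0 ≤ m)
    (hd : ∀ i, m ≤ d i) (hU : ∀ i j, 0 ≤ U i j) (hr : 0 ≤ r) (hUr : ∀ i, r ≤ ∑ j, U i j)
    (hV : ∀ i, ∑ j, V i j ≤ 1) (hγ0 : 0 ≤ γ) (hγ1 : γ ≤ 1) (n : ℕ) (i : I) :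
    ∑ j, (1 - ∑ k ∈ Finset.range n, γ ^ k • (Matrix.diagonal d * U ^ k * (1 - γ • V))) i j ≤
      1 - m * (1 - γ) * ∑ k ∈ Finset.range n, (γ * r) ^ k := by
  have hrow : ∀ i, 1 - γ ≤ ∑ j, (1 - γ • V) i j := fun i => by
    simp only [Matrix.sub_apply, Matrix.smul_apply, smul_eq_mul, Finset.sum_sub_distrib,
      Matrix.one_apply, Finset.sum_ite_eq, Finset.mem_univ, if_true, ← Finset.mul_sum]
    linarith [mul_le_mul_of_nonneg_left (hV i) hγ0]
  have hterm : ∀ k, m * (1 - γ) * (γ * r) ^ k ≤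
      ∑ j, (γ ^ k • (Matrix.diagonal d * U ^ k * (1 - γ • V))) i j := fun k => by
    simp only [Matrix.smul_apply, smul_eq_mul, ← Finset.mul_sum, mul_assoc (Matrix.diagonal d),
      Matrix.diagonal_mul]
    rw [sum_mul_apply]
    have h : r ^ k * (1 - γ) ≤ ∑ l, (U ^ k) i l * ∑ j, (1 - γ • V) l j :=
      calc r ^ k * (1 - γ) ≤ (∑ l, (U ^ k) i l) * (1 - γ) :=
            mul_le_mul_of_nonneg_right (pow_le_sum_pow_apply hU hr hUr k i) (sub_nonneg.2 hγ1)
        _ = ∑ l, (U ^ k) i l * (1 - γ) := Finset.sum_mul _ _ _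
        _ ≤ _ := Finset.sum_le_sum fun l _ =>
            mul_le_mul_of_nonneg_left (hrow l) (pow_apply_nonneg hU k i l)
    calc m * (1 - γ) * (γ * r) ^ k = γ ^ k * (m * (r ^ k * (1 - γ))) := by rw [mul_pow]; ring
      _ ≤ _ := mul_le_mul_of_nonneg_left
          (mul_le_mul (hd i) h (mul_nonneg (pow_nonneg hr k) (sub_nonneg.2 hγ1))
            (hm.trans (hd i))) (pow_nonneg hγ0 k)
  simp only [Matrix.sub_apply, Finset.sum_sub_distrib, Matrix.one_apply, Finset.sum_ite_eq,
    Finset.mem_univ, if_true, Matrix.sum_apply]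
  rw [Finset.sum_comm, Finset.mul_sum]
  exact sub_le_sub_left (Finset.sum_le_sum fun k _ => hterm k) 1

end NonnegMatrix

section Truncation

variable {S A : Type*} [Fintype A]

lemma IsPolicy.le_one {π : S → A → ℝ} (hπ : IsPolicy π) (s : S) (a : A) : π s a ≤ 1 :=
  hπ.2 s ▸ Finset.single_le_sum (f := π s) (fun a _ => hπ.1 s a) (Finset.mem_univ a)

lemma Psa_mul_truncDiag_apply [Fintype S] [DecidableEq S] [DecidableEq A]
    (P : A → Matrix S S ℝ) {πb π : S → A → ℝ} {r : ℝ}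
    (h : ∀ s a, 0 ≤ min (r * πb s a) (π s a)) (p q : S × A) :
    (Psa P (truncPolicy πb π r) * truncDiag πb π r) p q =
      P p.2 p.1 q.1 * min (r * πb q.1 q.2) (π q.1 q.2) := by
  rw [truncDiag, Matrix.mul_diagonal, Psa, Matrix.of_apply, truncPolicy, mul_assoc,
    div_mul_cancel_of_imp]
  intro h0
  exact (Finset.sum_eq_zero_iff_of_nonneg fun a _ => h q.1 a).1 h0 q.2 (Finset.mem_univ _)

lemma le_sum_min {πb π : S → A → ℝ} (hπ : IsPolicy π) {c r : ℝ} (hr0 : 0 ≤ r) (hr1 : r ≤ 1)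
    (h : ∀ s a, r ≤ c * πb s a) (s : S) : r ≤ ∑ a, min (c * πb s a) (π s a) := by
  calc r = ∑ a, r * π s a := by rw [← Finset.mul_sum, hπ.2, mul_one]
    _ ≤ _ := Finset.sum_le_sum fun a _ => le_min
        ((mul_le_of_le_one_right hr0 (hπ.le_one s a)).trans (h s a))
        (mul_le_of_le_one_left (hπ.1 s a) hr1)

lemma sum_min_le_one {πb π : S → A → ℝ} (hπ : IsPolicy π) (r : ℝ) (s : S) :
    ∑ a, min (r * πb s a) (π s a) ≤ 1 :=
  (Finset.sum_le_sum fun _ _ => min_le_right _ _).trans (hπ.2 s).le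

end Truncation

/-- The matrix `A` has nonnegative entries and `‖A‖_∞ ≤ γ_c` with
`γ_c = 1 − M_min(1−γ)(1−(γ C_min)^n)/(1−γ C_min) ∈ (0,1)`; in particular `Q ↦ A Q + b`
is a `γ_c`-contraction in the sup norm. -/
theorem expected_qtrace_contraction
    {S A : Type*} [Fintype S] [Fintype A] [Nonempty S] [Nonempty A]
    [DecidableEq S] [DecidableEq A]
    (P : A → Matrix S S ℝ) (hP : ∀ a, IsStochastic (P a))
    (γ : ℝ) (hγ0 : 0 < γ) (hγ1 : γ < 1)
    (n : ℕ) (hn : 1 ≤ n)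
    (πb : S → A → ℝ) (hπb : IsPolicy πb) (hπbpos : ∀ s a, 0 < πb s a)
    (c ρ : ℝ) (hc : 1 ≤ c) (hcρ : c ≤ ρ)
    (π : S → A → ℝ) (hπ : IsPolicy π)
    (μb : S → ℝ) (hμb0 : ∀ s, 0 < μb s) (hμb1 : ∑ s, μb s = 1)
    (Cmin Mmin γc : ℝ)
    (hCmin : Cmin = c * Finset.univ.inf' Finset.univ_nonempty (fun x : S × A => πb x.1 x.2))
    (hCle : Cmin ≤ 1)
    (hMmin : Mmin =
      Finset.univ.inf' Finset.univ_nonempty (fun x : S × A => μb x.1 * πb x.1 x.2))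
    (hγc : γc = 1 - Mmin * (1 - γ) * (1 - (γ * Cmin) ^ n) / (1 - γ * Cmin)) :
    (∀ p q : S × A, 0 ≤ AmatQ P πb π μb γ c ρ n p q) ∧
    matNorm (AmatQ P πb π μb γ c ρ n) ≤ γc ∧
    0 < γc ∧ γc < 1 ∧
    ∀ (b Q1 Q2 : S × A → ℝ),
      supNorm (((AmatQ P πb π μb γ c ρ n).mulVec Q1 + b)
          - ((AmatQ P πb π μb γ c ρ n).mulVec Q2 + b)) ≤
        γc * supNorm (Q1 - Q2) := by
  have hCpos : 0 < Cmin := by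
    rw [hCmin]
    exact mul_pos (by linarith) ((Finset.lt_inf'_iff _).2 fun x _ => hπbpos x.1 x.2)
  have hCb : ∀ s a, Cmin ≤ c * πb s a := fun s a => by
    rw [hCmin]
    exact mul_le_mul_of_nonneg_left
      (Finset.inf'_le (fun x : S × A => πb x.1 x.2) (Finset.mem_univ (s, a))) (by linarith)
  have hMpos : 0 < Mmin := by
    rw [hMmin]
    exact (Finset.lt_inf'_iff _).2 fun x _ => mul_pos (hμb0 x.1) (hπbpos x.1 x.2)
  have hMb : ∀ x : S × A, Mmin ≤ μb x.1 * πb x.1 x.2 := fun x => by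
    rw [hMmin]
    exact Finset.inf'_le (fun x : S × A => μb x.1 * πb x.1 x.2) (Finset.mem_univ x)
  have hd1 : ∀ x : S × A, μb x.1 * πb x.1 x.2 ≤ 1 := fun x =>
    mul_le_one₀ (hμb1 ▸ Finset.single_le_sum (f := μb) (fun s _ => (hμb0 s).le)
      (Finset.mem_univ x.1)) (hπb.1 _ _) (hπb.le_one _ _)
  have hmin : ∀ r, 1 ≤ r → ∀ s a, 0 ≤ min (r * πb s a) (π s a) := fun r hr s a =>
    le_min (mul_nonneg (by linarith) (hπb.1 s a)) (hπ.1 s a)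
  have hUc := Psa_mul_truncDiag_apply P (hmin c hc)
  have hUρ := Psa_mul_truncDiag_apply P (hmin ρ (hc.trans hcρ))
  have hU0 : ∀ p q, 0 ≤ (Psa P (truncPolicy πb π c) * truncDiag πb π c) p q := fun p q => by
    rw [hUc]
    exact mul_nonneg ((hP _).1 _ _) (hmin c hc _ _)
  have hUV : ∀ p q, (Psa P (truncPolicy πb π c) * truncDiag πb π c) p q ≤
      (Psa P (truncPolicy πb π ρ) * truncDiag πb π ρ) p q := fun p q => by
    rw [hUc, hUρ]
    exact mul_le_mul_of_nonneg_left
      (min_le_min_right _ (mul_le_mul_of_nonneg_right hcρ (hπb.1 _ _))) ((hP _).1 _ _)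
  have hUr : ∀ p, Cmin ≤ ∑ q, (Psa P (truncPolicy πb π c) * truncDiag πb π c) p q := fun p => by
    simp only [hUc, Fintype.sum_prod_type, ← Finset.mul_sum]
    calc Cmin = ∑ s, P p.2 p.1 s * Cmin := by rw [← Finset.sum_mul, (hP _).2, one_mul]
      _ ≤ _ := Finset.sum_le_sum fun s _ =>
        mul_le_mul_of_nonneg_left (le_sum_min hπ hCpos.le hCle hCb s) ((hP _).1 _ _)
  have hV1 : ∀ p, ∑ q, (Psa P (truncPolicy πb π ρ) * truncDiag πb π ρ) p q ≤ 1 := fun p => by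
    simp only [hUρ, Fintype.sum_prod_type, ← Finset.mul_sum]
    calc _ ≤ ∑ s, P p.2 p.1 s := Finset.sum_le_sum fun s _ =>
          mul_le_of_le_one_right ((hP _).1 _ _) (sum_min_le_one hπ ρ s)
      _ = 1 := (hP _).2 _
  have hγC : γ * Cmin ≤ γ := mul_le_of_le_one_right hγ0.le hCle
  have hgeom : γc = 1 - Mmin * (1 - γ) * ∑ k ∈ Finset.range n, (γ * Cmin) ^ k := by
    rw [hγc, mul_div_assoc, geom_sum_eq (by linarith), ← neg_div_neg_eq, neg_sub, neg_sub]
  have hA0 : ∀ p q, 0 ≤ AmatQ P πb π μb γ c ρ n p q :=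
    one_sub_sum_smul_nonneg (fun x => hMpos.le.trans (hMb x)) hd1 hU0 hUV hγ0.le n
  have hAn : matNorm (AmatQ P πb π μb γ c ρ n) ≤ γc := matNorm_le_of_nonneg hA0 fun p =>
    hgeom ▸ sum_one_sub_sum_smul_le hMpos.le hMb hU0 hCpos.le hUr hV1 hγ0.le hγ1.le n p
  refine ⟨hA0, hAn, ?_, ?_, fun b Q1 Q2 => ?_⟩
  · have hle : ∑ k ∈ Finset.range n, (γ * Cmin) ^ k ≤ ∑ k ∈ Finset.range n, γ ^ k :=
      Finset.sum_le_sum fun k _ => pow_le_pow_left₀ (by positivity) hγC k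
    have hM1 : Mmin ≤ 1 := (hMb (Classical.arbitrary _)).trans (hd1 _)
    have hγn : 0 < γ ^ n := pow_pos hγ0 n
    have hlt : (1 - γ) * ∑ k ∈ Finset.range n, (γ * Cmin) ^ k < 1 := by
      have h1 := mul_le_mul_of_nonneg_left hle (sub_nonneg.2 hγ1.le)
      rw [mul_neg_geom_sum] at h1
      linarith
    have hge : 0 ≤ (1 - γ) * ∑ k ∈ Finset.range n, (γ * Cmin) ^ k :=
      mul_nonneg (by linarith) (Finset.sum_nonneg fun k _ => by positivity)
    rw [hgeom, mul_assoc]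
    linarith [mul_le_of_le_one_left hge hM1]
  · have hpos : 0 < ∑ k ∈ Finset.range n, (γ * Cmin) ^ k :=
      Finset.sum_pos (fun k _ => by positivity) (Finset.nonempty_range_iff.2 (by omega))
    rw [hgeom]
    linarith [mul_pos (mul_pos hMpos (sub_pos.2 hγ1)) hpos]
  · rw [add_sub_add_right_eq_sub, ← Matrix.mulVec_sub]
    exact (supNorm_mulVec_le _ _).trans
      (mul_le_mul_of_nonneg_right hAn (supNorm_nonneg _))
end

section
/- Let π be a policy with π(a|s) > 0 for all (s,a) and let π' be its NPG update with respect to Q̂ and stepsize β. Then for any probability distribution μ on S: V^{π'}(μ) − V^π(μ) ≥ (1/(1−γ)) Σ_s d_μ^{π'}(s) Σ_a (π(a|s) − π'(a|s)) (Q̂(s,a) − Q^π(s,a)) − Σ_s μ(s) Σ_a π(a|s) (Q̂(s,a) − Q^π(s,a)) + (1/β) Σ_s μ(s) log Z(s). -/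
/-- The NPG update of policy `π` with respect to `Q̂` and stepsize `β`. -/
noncomputable def npg {S A : Type*} [Fintype A] (π : S → A → ℝ) (β : ℝ)
    (Qh : S × A → ℝ) : S → A → ℝ :=
  fun s a => π s a * Real.exp (β * Qh (s, a)) / ∑ a', π s a' * Real.exp (β * Qh (s, a'))

/-- The induced state transition matrix `P̃_π(s,s') = Σ_a π(a|s) P_a(s,s')`. -/
noncomputable def PtildeGen {S A : Type*} [Fintype A] (P : A → Matrix S S ℝ)
    (π : S → A → ℝ) : Matrix S S ℝ :=
  Matrix.of fun s s' => ∑ a, π s a * P a s s'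

/-- The discounted state visitation distribution
`d_μ^π(s) = (1−γ) Σ_{j=0}^∞ γ^j (μᵀ P̃_π^j)(s)`. -/
noncomputable def dvisit {S A : Type*} [Fintype S] [Fintype A] [DecidableEq S]
    (P : A → Matrix S S ℝ) (π : S → A → ℝ) (γ : ℝ) (μ : S → ℝ) : S → ℝ :=
  fun s => (1 - γ) * ∑' j : ℕ, γ ^ j * Matrix.vecMul μ (PtildeGen P π ^ j) s

/-- KL divergence `Σ_a p(a) log(p(a)/q(a))` between distributions on actions. -/
noncomputable def klA {A : Type*} [Fintype A] (p q : A → ℝ) : ℝ :=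
  ∑ a, p a * Real.log (p a / q a)

theorem IsPolicy.isStochastic_PtildeGen {S A : Type*} [Fintype S] [Fintype A]
    {P : A → Matrix S S ℝ} (hP : ∀ a, IsStochastic (P a)) {π : S → A → ℝ} (hπ : IsPolicy π) :
    IsStochastic (PtildeGen P π) := by
  refine ⟨fun s s' => Finset.sum_nonneg fun a _ => mul_nonneg (hπ.1 s a) ((hP a).1 s s'),
    fun s => ?_⟩
  simp only [PtildeGen, Matrix.of_apply]
  rw [Finset.sum_comm]
  simp only [← Finset.mul_sum, (hP _).2, mul_one, hπ.2]

theorem IsStochastic.vecMul_pow_nonneg {S : Type*} [Fintype S] [DecidableEq S] {K : Matrix S S ℝ}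
    (hK : IsStochastic K) {μ : S → ℝ} (hμ : ∀ s, 0 ≤ μ s) (j : ℕ) (s : S) :
    0 ≤ Matrix.vecMul μ (K ^ j) s := by
  induction j generalizing s with
  | zero => simpa using hμ s
  | succ j ih =>
    rw [pow_succ, ← Matrix.vecMul_vecMul]
    exact Finset.sum_nonneg fun i _ => mul_nonneg (ih i) (hK.1 i s)

theorem IsStochastic.sum_vecMul_pow {S : Type*} [Fintype S] [DecidableEq S] {K : Matrix S S ℝ}
    (hK : IsStochastic K) (μ : S → ℝ) (j : ℕ) :
    ∑ s, Matrix.vecMul μ (K ^ j) s = ∑ s, μ s := by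
  induction j with
  | zero => simp
  | succ j ih =>
    rw [← ih, pow_succ, ← Matrix.vecMul_vecMul]
    change ∑ s, ∑ i, Matrix.vecMul μ (K ^ j) i * K i s = _
    rw [Finset.sum_comm]
    simp only [← Finset.mul_sum, hK.2, mul_one]

theorem IsStochastic.summable_discounted {S : Type*} [Fintype S] [DecidableEq S]
    {K : Matrix S S ℝ} (hK : IsStochastic K) {γ : ℝ} (hγ0 : 0 ≤ γ) (hγ1 : γ < 1) {μ : S → ℝ}
    (hμ : ∀ s, 0 ≤ μ s) (s : S) :
    Summable fun j : ℕ => γ ^ j * Matrix.vecMul μ (K ^ j) s := by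
  refine Summable.of_nonneg_of_le
    (fun j => mul_nonneg (pow_nonneg hγ0 j) (hK.vecMul_pow_nonneg hμ j s)) (fun j => ?_)
    ((summable_geometric_of_lt_one hγ0 hγ1).mul_right (∑ s, μ s))
  refine mul_le_mul_of_nonneg_left ?_ (pow_nonneg hγ0 j)
  rw [← hK.sum_vecMul_pow μ j]
  exact Finset.single_le_sum (fun i _ => hK.vecMul_pow_nonneg hμ j i) (Finset.mem_univ s)

/-- The visitation distribution satisfies the balance equation `d = (1 - γ) μ + γ d P̃_π`. -/
theorem dvisit_eq {S A : Type*} [Fintype S] [Fintype A] [DecidableEq S]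
    {P : A → Matrix S S ℝ} {π : S → A → ℝ} (hK : IsStochastic (PtildeGen P π))
    {γ : ℝ} (hγ0 : 0 ≤ γ) (hγ1 : γ < 1) {μ : S → ℝ} (hμ : ∀ s, 0 ≤ μ s) (s : S) :
    dvisit P π γ μ s =
      (1 - γ) * μ s + γ * ∑ i, dvisit P π γ μ i * PtildeGen P π i s := by
  have hsum := hK.summable_discounted hγ0 hγ1 hμ
  have hstep : ∀ j : ℕ, γ ^ (j + 1) * Matrix.vecMul μ (PtildeGen P π ^ (j + 1)) s =
      γ * ∑ i, γ ^ j * Matrix.vecMul μ (PtildeGen P π ^ j) i * PtildeGen P π i s := by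
    intro j
    rw [pow_succ (PtildeGen P π), ← Matrix.vecMul_vecMul]
    change _ * ∑ i, Matrix.vecMul μ (PtildeGen P π ^ j) i * PtildeGen P π i s = _
    rw [Finset.mul_sum, Finset.mul_sum]
    exact Finset.sum_congr rfl fun i _ => by ring
  simp only [dvisit]
  rw [(hsum s).tsum_eq_zero_add]
  simp only [hstep]
  rw [tsum_mul_left, Summable.tsum_finsetSum fun i _ => (hsum i).mul_right _]
  simp only [tsum_mul_right]
  simp only [pow_zero, Matrix.vecMul_one, one_mul, mul_assoc, ← Finset.mul_sum]
  ring

theorem le_dvisit {S A : Type*} [Fintype S] [Fintype A] [DecidableEq S]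
    {P : A → Matrix S S ℝ} {π : S → A → ℝ} (hK : IsStochastic (PtildeGen P π))
    {γ : ℝ} (hγ0 : 0 ≤ γ) (hγ1 : γ < 1) {μ : S → ℝ} (hμ : ∀ s, 0 ≤ μ s) (s : S) :
    (1 - γ) * μ s ≤ dvisit P π γ μ s := by
  refine mul_le_mul_of_nonneg_left ?_ (by linarith)
  simpa using (hK.summable_discounted hγ0 hγ1 hμ s).le_tsum 0
    fun j _ => mul_nonneg (pow_nonneg hγ0 j) (hK.vecMul_pow_nonneg hμ j s)

theorem sum_dvisit_mul_of_eq_add {S A : Type*} [Fintype S] [Fintype A] [DecidableEq S]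
    {P : A → Matrix S S ℝ} {π : S → A → ℝ} (hK : IsStochastic (PtildeGen P π))
    {γ : ℝ} (hγ0 : 0 ≤ γ) (hγ1 : γ < 1) {μ : S → ℝ} (hμ : ∀ s, 0 ≤ μ s) {f g : S → ℝ}
    (hf : ∀ s, f s = g s + γ * ∑ s', PtildeGen P π s s' * f s') :
    (1 - γ) * ∑ s, μ s * f s = ∑ s, dvisit P π γ μ s * g s := by
  have hg : ∀ s, g s = f s - γ * ∑ s', PtildeGen P π s s' * f s' := fun s => by
    linarith [hf s]
  have hbal : ∑ s, dvisit P π γ μ s * f s = (1 - γ) * ∑ s, μ s * f s +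
      γ * ∑ s, (∑ i, dvisit P π γ μ i * PtildeGen P π i s) * f s := by
    rw [Finset.mul_sum, Finset.mul_sum, ← Finset.sum_add_distrib]
    refine Finset.sum_congr rfl fun s _ => ?_
    conv_lhs => rw [dvisit_eq hK hγ0 hγ1 hμ s]
    ring
  have hswap : ∑ s, (∑ i, dvisit P π γ μ i * PtildeGen P π i s) * f s =
      ∑ s, dvisit P π γ μ s * ∑ s', PtildeGen P π s s' * f s' := by
    simp only [Finset.sum_mul, Finset.mul_sum, mul_assoc]
    exact Finset.sum_comm
  simp only [hg, mul_sub, mul_left_comm _ γ, Finset.sum_sub_distrib]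
  rw [← Finset.mul_sum, ← hswap]
  linarith

theorem bellman_apply {S A : Type*} [Fintype S] [Fintype A] {P : A → Matrix S S ℝ}
    {R : S × A → ℝ} {γ : ℝ} {π : S → A → ℝ} {Q : S × A → ℝ}
    (hQ : Q = R + γ • (Psa P π).mulVec Q) (s : S) (a : A) :
    Q (s, a) = R (s, a) + γ * ∑ s', P a s s' * ∑ a', π s' a' * Q (s', a') := by
  conv_lhs => rw [hQ]
  simp [Matrix.mulVec, dotProduct, Psa, Fintype.sum_prod_type, Finset.mul_sum, mul_assoc]

/-- The performance difference lemma. -/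
theorem performance_difference {S A : Type*} [Fintype S] [Fintype A] [DecidableEq S]
    {P : A → Matrix S S ℝ} (hP : ∀ a, IsStochastic (P a)) {R : S × A → ℝ}
    {γ : ℝ} (hγ0 : 0 ≤ γ) (hγ1 : γ < 1) {π π' : S → A → ℝ} (hπ' : IsPolicy π')
    {Q Q' : S × A → ℝ} (hQ : Q = R + γ • (Psa P π).mulVec Q)
    (hQ' : Q' = R + γ • (Psa P π').mulVec Q') {μ : S → ℝ} (hμ : ∀ s, 0 ≤ μ s) :
    (1 - γ) * ((∑ s, μ s * ∑ a, π' s a * Q' (s, a)) - ∑ s, μ s * ∑ a, π s a * Q (s, a)) =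
      ∑ s, dvisit P π' γ μ s *
        ((∑ a, π' s a * Q (s, a)) - ∑ a, π s a * Q (s, a)) := by
  rw [← sum_dvisit_mul_of_eq_add (hπ'.isStochastic_PtildeGen hP) hγ0 hγ1 hμ
    (f := fun s => (∑ a, π' s a * Q' (s, a)) - ∑ a, π s a * Q (s, a))]
  · simp only [mul_sub, Finset.sum_sub_distrib]
  intro s
  have hdiff : ∀ a, Q' (s, a) = Q (s, a) + γ * ∑ s', P a s s' *
      ((∑ a', π' s' a' * Q' (s', a')) - ∑ a', π s' a' * Q (s', a')) := fun a => by
    rw [bellman_apply hQ' s a, bellman_apply hQ s a]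
    simp only [mul_sub, Finset.sum_sub_distrib]
    ring
  have hsum : ∑ a, π' s a * Q' (s, a) = (∑ a, π' s a * Q (s, a)) +
      γ * ∑ s', PtildeGen P π' s s' *
        ((∑ a', π' s' a' * Q' (s', a')) - ∑ a', π s' a' * Q (s', a')) := by
    conv_lhs => enter [2, a]; rw [hdiff a, mul_add, mul_left_comm, Finset.mul_sum]
    rw [Finset.sum_add_distrib, ← Finset.mul_sum, Finset.sum_comm]
    simp only [PtildeGen, Matrix.of_apply, Finset.sum_mul, mul_assoc]
  linarith

theorem sum_mul_le_log_sum_mul_exp {A : Type*} [Fintype A] {p : A → ℝ} (hp : ∀ a, 0 ≤ p a)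
    (hp1 : ∑ a, p a = 1) (x : A → ℝ) :
    ∑ a, p a * x a ≤ Real.log (∑ a, p a * Real.exp (x a)) := by
  have h := convexOn_exp.map_sum_le (t := Finset.univ) (w := p) (p := x)
    (fun a _ => hp a) hp1 fun _ _ => Set.mem_univ _
  simp only [smul_eq_mul] at h
  exact (Real.le_log_iff_exp_le ((Real.exp_pos _).trans_le h)).2 h

theorem log_sum_mul_exp_le_sum_mul {A : Type*} [Fintype A] {p q x : A → ℝ} (hp1 : ∑ a, p a = 1)
    (hq : ∀ a, 0 ≤ q a) (hq1 : ∑ a, q a = 1)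
    (hqp : ∀ a, q a = p a * Real.exp (x a) / ∑ b, p b * Real.exp (x b)) :
    Real.log (∑ a, p a * Real.exp (x a)) ≤ ∑ a, q a * x a := by
  have h := sum_mul_le_log_sum_mul_exp hq hq1 fun a => -x a
  have hterm : ∀ a, q a * Real.exp (-x a) = p a / ∑ b, p b * Real.exp (x b) := fun a => by
    rw [hqp a, div_mul_eq_mul_div, mul_assoc, ← Real.exp_add, add_neg_cancel, Real.exp_zero,
      mul_one]
  simp only [hterm, ← Finset.sum_div, hp1, one_div, Real.log_inv, mul_neg,
    Finset.sum_neg_distrib] at h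
  linarith

theorem npg_eq_shift {S A : Type*} [Fintype A] (π : S → A → ℝ) (β : ℝ) (Qh : S × A → ℝ)
    (s : S) (a : A) (c : ℝ) :
    npg π β Qh s a = π s a * Real.exp (β * (Qh (s, a) - c)) /
      ∑ b, π s b * Real.exp (β * (Qh (s, b) - c)) := by
  simp only [npg, mul_sub, Real.exp_sub, ← mul_div_assoc, ← Finset.sum_div]
  rw [div_div_div_cancel_right₀ (Real.exp_ne_zero _)]

theorem isPolicy_npg {S A : Type*} [Fintype A] [Nonempty A] {π : S → A → ℝ}
    (hπ : ∀ s a, 0 < π s a) (β : ℝ) (Qh : S × A → ℝ) : IsPolicy (npg π β Qh) := by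
  have hZ : ∀ s, 0 < ∑ a, π s a * Real.exp (β * Qh (s, a)) := fun s =>
    Finset.sum_pos (fun a _ => mul_pos (hπ s a) (Real.exp_pos _)) Finset.univ_nonempty
  refine ⟨fun s a => div_nonneg (mul_pos (hπ s a) (Real.exp_pos _)).le (hZ s).le, fun s => ?_⟩
  simp only [npg, ← Finset.sum_div]
  exact div_self (hZ s).ne'

/-- For the NPG update `π'` of `π` with respect to `Q̂` and stepsize `β`,
and any initial distribution `μ`:
`V^{π'}(μ) − V^π(μ) ≥ (1/(1−γ)) Σ_s d_μ^{π'}(s) Σ_a (π(a|s) − π'(a|s))(Q̂(s,a) − Q^π(s,a))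
  − Σ_s μ(s) Σ_a π(a|s)(Q̂(s,a) − Q^π(s,a)) + (1/β) Σ_s μ(s) log Z(s)`. -/
theorem npg_improvement_lower_bound
    {S A : Type*} [Fintype S] [Fintype A] [Nonempty S] [Nonempty A] [DecidableEq S]
    (P : A → Matrix S S ℝ) (hP : ∀ a, IsStochastic (P a))
    (R : S × A → ℝ) (hR : ∀ x, 0 ≤ R x ∧ R x ≤ 1)
    (γ : ℝ) (hγ0 : 0 < γ) (hγ1 : γ < 1)
    (π : S → A → ℝ) (hπ : IsPolicy π) (hπpos : ∀ s a, 0 < π s a)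
    (β : ℝ) (hβ : 0 < β) (Qh : S × A → ℝ)
    (Qpi : S × A → ℝ) (hQpi : Qpi = R + γ • (Psa P π).mulVec Qpi)
    (Qpi' : S × A → ℝ) (hQpi' : Qpi' = R + γ • (Psa P (npg π β Qh)).mulVec Qpi')
    (μ : S → ℝ) (hμ0 : ∀ s, 0 ≤ μ s) (hμ1 : ∑ s, μ s = 1) :
    (∑ s, μ s * (∑ a, npg π β Qh s a * Qpi' (s, a)))
        - (∑ s, μ s * (∑ a, π s a * Qpi (s, a))) ≥
      (1 / (1 - γ)) * (∑ s, dvisit P (npg π β Qh) γ μ s *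
          (∑ a, (π s a - npg π β Qh s a) * (Qh (s, a) - Qpi (s, a))))
        - (∑ s, μ s * (∑ a, π s a * (Qh (s, a) - Qpi (s, a))))
        + (1 / β) * (∑ s, μ s * Real.log (∑ a, π s a *
            Real.exp (β * (Qh (s, a) - ∑ a', π s a' * Qpi (s, a'))))) := by
  have hπ' := isPolicy_npg hπpos β Qh
  have hK := hπ'.isStochastic_PtildeGen hP
  have hγ : 0 < 1 - γ := by linarith
  have hpd := performance_difference hP hγ0.le hγ1 hπ' hQpi hQpi' hμ0
  set π' := npg π β Qh with hπ'_def
  set V : S → ℝ := fun s => ∑ a, π s a * Qpi (s, a) with hV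
  set L : S → ℝ := fun s => Real.log (∑ a, π s a * Real.exp (β * (Qh (s, a) - V s))) with hL
  set D : S → ℝ := fun s => ∑ a, π s a * (Qh (s, a) - Qpi (s, a)) with hD
  set E : S → ℝ := fun s => ∑ a, (π s a - π' s a) * (Qh (s, a) - Qpi (s, a)) with hE
  set d := dvisit P π' γ μ with hd
  have hdμ : ∀ s, (1 - γ) * μ s ≤ d s := le_dvisit hK hγ0.le hγ1 hμ0
  have hDL : ∀ s, D s ≤ 1 / β * L s := fun s => by
    have h := sum_mul_le_log_sum_mul_exp (hπ.1 s) (hπ.2 s) fun a => β * (Qh (s, a) - V s)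
    have hsum : ∑ a, π s a * (β * (Qh (s, a) - V s)) = β * D s := by
      simp only [hD, mul_left_comm _ β, ← Finset.mul_sum, mul_sub, Finset.sum_sub_distrib,
        ← Finset.sum_mul, hπ.2 s, one_mul, hV]
    rw [one_div, ← div_eq_inv_mul, le_div_iff₀ hβ]
    linarith
  have hgain : ∀ s, 1 / β * L s - D s + E s ≤ (∑ a, π' s a * Qpi (s, a)) - V s := fun s => by
    have h := log_sum_mul_exp_le_sum_mul (hπ.2 s) (hπ'.1 s) (hπ'.2 s)
      (fun a => npg_eq_shift π β Qh s a (V s))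
    have hsum : ∑ a, π' s a * (β * (Qh (s, a) - V s)) =
        β * ((∑ a, π' s a * Qpi (s, a)) - V s + D s - E s) := by
      simp only [hD, hE, mul_left_comm _ β, ← Finset.mul_sum, mul_sub, sub_mul,
        Finset.sum_sub_distrib, ← Finset.sum_mul, hπ'.2 s, one_mul]
      ring
    have hle : 1 / β * L s ≤ (∑ a, π' s a * Qpi (s, a)) - V s + D s - E s := by
      rw [one_div, ← div_eq_inv_mul, div_le_iff₀ hβ]
      linarith
    linarith
  have hterm : ∀ s, (1 - γ) * (μ s * (1 / β * L s - D s)) + d s * E s ≤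
      d s * ((∑ a, π' s a * Qpi (s, a)) - V s) := fun s => by
    have h1 := mul_le_mul_of_nonneg_right (hdμ s) (sub_nonneg.2 (hDL s))
    have h2 := mul_le_mul_of_nonneg_left (hgain s)
      ((mul_nonneg hγ.le (hμ0 s)).trans (hdμ s))
    linarith
  have hsum := Finset.sum_le_sum fun s (_ : s ∈ Finset.univ) => hterm s
  rw [← hpd, Finset.sum_add_distrib, ← Finset.mul_sum] at hsum
  have hsplit : ∑ s, μ s * (1 / β * L s - D s) =
      1 / β * ∑ s, μ s * L s - ∑ s, μ s * D s := by
    simp only [mul_sub, Finset.sum_sub_distrib, mul_left_comm _ (1 / β), ← Finset.mul_sum]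
  rw [hsplit] at hsum
  refine le_of_mul_le_mul_left ?_ hγ
  refine le_trans (le_of_eq ?_) hsum
  field_simp
  ring
end
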